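/- arXiv:2401.05045 — 2 statements merged into one kernel-verified Lean document; each statement's English description precedes it below -/
import Mathlib

section
/- Let A > 0 and λ ≥ 0, and let P_{X*} be a capacity-achieving input distribution of the amplitude-constrained discrete-time Poisson channel. Then |supp(P_{X*})| ≥ ⌈max{2, e^{C(A,λ)}}⌉. -/
open MeasureTheory Real Set

noncomputable section

/-- Poisson transition pmf with dark current `lam`:
`P_{Y|X}(y|x) = (x+lam)^y e^{-(x+lam)} / y!` (with the convention `0^0 = 1`). -/
def channelPMF (lam x : ℝ) (y : ℕ) : ℝ :=
  (x + lam) ^ y * Real.exp (-(x + lam)) / (Nat.factorial y)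

/-- Output pmf induced by the input distribution `μ`. -/
def outputPMF (lam : ℝ) (μ : Measure ℝ) (y : ℕ) : ℝ :=
  ∫ x, channelPMF lam x y ∂μ

/-- Kullback–Leibler divergence between pmfs on `ℕ` (natural logarithm). -/
def klDiv (p q : ℕ → ℝ) : ℝ :=
  ∑' y, p y * Real.log (p y / q y)

/-- The function `i(x; μ) = D(P_{Y|X}(·|x) ‖ P_Y^μ)`. -/
def iFun (lam : ℝ) (μ : Measure ℝ) (x : ℝ) : ℝ :=
  klDiv (channelPMF lam x) (outputPMF lam μ)

/-- Mutual information for input distribution `μ`. -/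
def mutualInfo (lam : ℝ) (μ : Measure ℝ) : ℝ :=
  ∫ x, iFun lam μ x ∂μ

/-- Admissible input distributions: probability measures supported in `[0, A]`. -/
def IsInput (A : ℝ) (μ : Measure ℝ) : Prop :=
  IsProbabilityMeasure μ ∧ μ (Set.Icc 0 A)ᶜ = 0

/-- The capacity `C(A, lam)` of the amplitude-constrained Poisson channel. -/
def capacity (A lam : ℝ) : ℝ :=
  sSup (mutualInfo lam '' {μ : Measure ℝ | IsInput A μ})

/-- A capacity-achieving input distribution. -/
def IsCapacityAchieving (A lam : ℝ) (μ : Measure ℝ) : Prop :=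
  IsInput A μ ∧ mutualInfo lam μ = capacity A lam

/-- Topological support of a measure on `ℝ`. -/
def msupport (μ : Measure ℝ) : Set ℝ :=
  {x | ∀ U : Set ℝ, IsOpen U → x ∈ U → 0 < μ U}

theorem channelPMF_nonneg {lam x : ℝ} (hx : 0 ≤ x + lam) (y : ℕ) : 0 ≤ channelPMF lam x y := by
  unfold channelPMF
  positivity

theorem continuous_channelPMF (lam : ℝ) (y : ℕ) : Continuous fun x => channelPMF lam x y := by
  unfold channelPMF
  fun_prop

theorem hasSum_channelPMF (lam x : ℝ) : HasSum (channelPMF lam x) 1 := by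
  have h := (NormedSpace.expSeries_div_hasSum_exp (x + lam)).mul_left (Real.exp (-(x + lam)))
  rw [← Real.exp_eq_exp_ℝ, ← Real.exp_add, neg_add_cancel, Real.exp_zero] at h
  refine h.congr_fun fun y => ?_
  unfold channelPMF
  ring

theorem hasSum_mul_channelPMF (lam x : ℝ) :
    HasSum (fun y : ℕ => (y : ℝ) * channelPMF lam x y) (x + lam) := by
  have h := (hasSum_channelPMF lam x).mul_left (x + lam)
  rw [mul_one] at h
  rw [← hasSum_nat_add_iff' 1]
  simp only [Finset.sum_range_one, Nat.cast_zero, zero_mul, sub_zero]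
  refine h.congr_fun fun y => ?_
  unfold channelPMF
  rw [Nat.factorial_succ]
  have : (y.factorial : ℝ) ≠ 0 := by positivity
  push_cast
  field_simp
  ring

theorem IsInput.ae_mem {A : ℝ} {μ : Measure ℝ} (h : IsInput A μ) : ∀ᵐ x ∂μ, x ∈ Icc 0 A :=
  h.2

theorem IsInput.integrable {A : ℝ} {μ : Measure ℝ} (h : IsInput A μ) {f : ℝ → ℝ}
    (hf : Continuous f) : Integrable f μ := by
  have := h.1
  rw [← Measure.restrict_eq_self_of_ae_mem h.ae_mem]
  exact hf.continuousOn.integrableOn_Icc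

/-- If `p ≤ c * q`, the divergence is at most `log c`, even when its series diverges. -/
theorem klDiv_le_log {p q : ℕ → ℝ} {c : ℝ} (hc : 1 ≤ c) (hp : ∀ y, 0 ≤ p y) (hp1 : HasSum p 1)
    (hq : ∀ y, 0 ≤ q y) (h : ∀ y, p y ≤ c * q y) : klDiv p q ≤ Real.log c := by
  unfold klDiv
  by_cases hs : Summable fun y => p y * Real.log (p y / q y)
  · refine hasSum_le (fun y => ?_) hs.hasSum (by simpa using hp1.mul_right (Real.log c))
    rcases (hp y).eq_or_lt with h0 | h0
    · simp [← h0]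
    · have hq0 : 0 < q y := by
        rcases (hq y).eq_or_lt with h1 | h1
        · have := h y
          rw [← h1] at this
          linarith
        · exact h1
      refine mul_le_mul_of_nonneg_left (Real.log_le_log (by positivity) ?_) h0.le
      exact (div_le_iff₀ hq0).2 (h y)
  · rw [tsum_eq_zero_of_not_summable hs]
    exact Real.log_nonneg hc

/-- Strict Gibbs inequality for pmfs with bounded likelihood ratio. -/
theorem klDiv_pos {p q : ℕ → ℝ} {c : ℝ} (hp : ∀ y, 0 ≤ p y) (hp1 : HasSum p 1)
    (hq : ∀ y, 0 ≤ q y) (hq1 : HasSum q 1) (h : ∀ y, p y ≤ c * q y)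
    {n : ℕ} (hpn : 0 < p n) (hn : p n ≠ q n) : 0 < klDiv p q := by
  have hq0 : ∀ y, 0 < p y → 0 < q y := fun y hy => by
    rcases (hq y).eq_or_lt with h1 | h1
    · have := h y
      rw [← h1] at this
      linarith
    · exact h1
  have hlow : ∀ y, p y - q y ≤ p y * Real.log (p y / q y) := fun y => by
    rcases (hp y).eq_or_lt with h0 | h0
    · simp [← h0, hq y]
    · have := mul_le_mul_of_nonneg_left
        (Real.one_sub_inv_le_log_of_pos (div_pos h0 (hq0 y h0))) h0.le
      refine le_trans (le_of_eq ?_) this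
      field_simp
  have hup : ∀ y, p y * Real.log (p y / q y) ≤ p y * Real.log c := fun y => by
    rcases (hp y).eq_or_lt with h0 | h0
    · simp [← h0]
    · exact mul_le_mul_of_nonneg_left (Real.log_le_log (div_pos h0 (hq0 y h0))
        ((div_le_iff₀ (hq0 y h0)).2 (h y))) h0.le
  have hd : HasSum (fun y => p y - q y) 0 := by simpa using hp1.sub hq1
  have hs : Summable fun y => p y * Real.log (p y / q y) := by
    have h1 : Summable fun y => p y * Real.log (p y / q y) - (p y - q y) :=
      Summable.of_nonneg_of_le (fun y => sub_nonneg.2 (hlow y))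
        (fun y => sub_le_sub_right (hup y) _) ((hp1.mul_right (Real.log c)).sub hd).summable
    simpa using h1.add hd.summable
  have hlt : p n - q n < p n * Real.log (p n / q n) := by
    have hqn := hq0 n hpn
    have h1 := Real.log_lt_sub_one_of_pos (div_pos hqn hpn)
      (fun he => hn ((div_eq_one_iff_eq hpn.ne').1 he).symm)
    have h2 : Real.log (p n / q n) = -Real.log (q n / p n) := by rw [← Real.log_inv, inv_div]
    have h3 := mul_lt_mul_of_pos_left h1 hpn
    have h4 : p n * (q n / p n - 1) = q n - p n := by field_simp
    rw [h2]
    linarith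
  have := Summable.tsum_lt_tsum hlow hlt hd.summable hs
  rwa [hd.tsum_eq] at this

theorem outputPMF_lower_bound {A lam : ℝ} (hlam : 0 ≤ lam) {μ : Measure ℝ} (hμ : IsInput A μ)
    (y : ℕ) :
    (∫ x, (x + lam) ∂μ) ^ y * Real.exp (-(A + lam)) / y.factorial ≤ outputPMF lam μ y := by
  have := hμ.1
  have hJ : (∫ x, (x + lam) ∂μ) ^ y ≤ ∫ x, (x + lam) ^ y ∂μ :=
    (convexOn_pow y).map_integral_le (by fun_prop) isClosed_Ici
      (hμ.ae_mem.mono fun x hx => add_nonneg hx.1 hlam)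
      (hμ.integrable (by fun_prop)) (hμ.integrable (by unfold Function.comp; fun_prop))
  calc (∫ x, (x + lam) ∂μ) ^ y * Real.exp (-(A + lam)) / y.factorial
      ≤ (∫ x, (x + lam) ^ y ∂μ) * Real.exp (-(A + lam)) / y.factorial := by gcongr
    _ = ∫ x, (x + lam) ^ y * Real.exp (-(A + lam)) / y.factorial ∂μ := by
        rw [integral_div, integral_mul_const]
    _ ≤ outputPMF lam μ y := by
        refine integral_mono_ae (hμ.integrable (by fun_prop))
          (hμ.integrable (continuous_channelPMF lam y)) ?_
        filter_upwards [hμ.ae_mem] with x hx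
        have : 0 ≤ x + lam := add_nonneg hx.1 hlam
        have := hx.2
        unfold channelPMF
        gcongr

theorem iFun_le {A lam : ℝ} (hA : 0 < A) (hlam : 0 ≤ lam) {μ : Measure ℝ} (hμ : IsInput A μ)
    {x : ℝ} (hx : x ∈ Icc 0 A) (hM : 0 < x + lam → 0 < ∫ t, (t + lam) ∂μ)
    (hL : 0 ≤ Real.log ((A + lam) / ∫ t, (t + lam) ∂μ)) :
    iFun lam μ x ≤ (x + lam) * Real.log ((A + lam) / ∫ t, (t + lam) ∂μ) + (A + lam) := by
  have hz : 0 ≤ x + lam := add_nonneg hx.1 hlam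
  set M := ∫ t, (t + lam) ∂μ with hMdef
  set L := Real.log ((A + lam) / M) with hLdef
  unfold iFun klDiv
  by_cases hs : Summable fun y =>
      channelPMF lam x y * Real.log (channelPMF lam x y / outputPMF lam μ y)
  · have hsum := ((hasSum_mul_channelPMF lam x).mul_right L).add
      ((hasSum_channelPMF lam x).mul_right (A + lam))
    rw [one_mul] at hsum
    refine hasSum_le (fun y => ?_) hs.hasSum hsum
    have hle : channelPMF lam x y ≠ 0 →
        Real.log (channelPMF lam x y / outputPMF lam μ y) ≤ y * L + (A + lam) := by
      intro hp
      have hq := outputPMF_lower_bound hlam hμ y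
      rw [← hMdef] at hq
      rcases hz.eq_or_lt with h0 | h0
      · have hy : y = 0 := by
          by_contra hy
          exact hp (by simp [channelPMF, ← h0, hy])
        subst hy
        simp only [pow_zero, one_mul, Nat.factorial_zero, Nat.cast_one, div_one] at hq
        have hq0 := (Real.exp_pos _).trans_le hq
        have hp1 : channelPMF lam x 0 = 1 := by simp [channelPMF, ← h0]
        rw [hp1, one_div, Real.log_inv]
        have := Real.log_le_log (Real.exp_pos _) hq
        rw [Real.log_exp] at this
        simp only [Nat.cast_zero, zero_mul, zero_add]
        linarith
      · have hM0 := hM h0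
        have hlow : 0 < M ^ y * Real.exp (-(A + lam)) / y.factorial := by positivity
        have hp0 : 0 < channelPMF lam x y := (channelPMF_nonneg hz y).lt_of_ne' hp
        calc Real.log (channelPMF lam x y / outputPMF lam μ y)
            ≤ Real.log (((A + lam) / M) ^ y * Real.exp (A + lam)) := by
              refine Real.log_le_log (div_pos hp0 (hlow.trans_le hq)) ?_
              rw [div_le_iff₀ (hlow.trans_le hq)]
              refine le_trans ?_ (mul_le_mul_of_nonneg_left hq (by positivity))
              have : ((A + lam) / M) ^ y * Real.exp (A + lam) *
                  (M ^ y * Real.exp (-(A + lam)) / y.factorial) =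
                  (A + lam) ^ y / y.factorial := by
                rw [Real.exp_neg, div_pow]
                field_simp
              rw [this]
              unfold channelPMF
              have h1 : Real.exp (-(x + lam)) ≤ 1 := Real.exp_le_one_iff.2 (by linarith)
              have h2 : (x + lam) ^ y ≤ (A + lam) ^ y := by
                have := hx.2
                gcongr
              gcongr
              exact (mul_le_of_le_one_right (by positivity) h1).trans h2
          _ = y * L + (A + lam) := by
              rw [Real.log_mul (by positivity) (Real.exp_pos _).ne', Real.log_pow, Real.log_exp]
    by_cases hp : channelPMF lam x y = 0
    · simp [hp]
    · refine (mul_le_mul_of_nonneg_left (hle hp) (channelPMF_nonneg hz y)).trans (le_of_eq ?_)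
      ring
  · rw [tsum_eq_zero_of_not_summable hs]
    positivity

theorem mutualInfo_le {A lam : ℝ} (hA : 0 < A) (hlam : 0 ≤ lam) {μ : Measure ℝ}
    (hμ : IsInput A μ) : mutualInfo lam μ ≤ 2 * (A + lam) := by
  have := hμ.1
  have hnn : 0 ≤ᵐ[μ] fun x => x + lam := hμ.ae_mem.mono fun x hx => add_nonneg hx.1 hlam
  have hint : Integrable (fun x => x + lam) μ := hμ.integrable (by fun_prop)
  have hM0 : 0 ≤ ∫ t, (t + lam) ∂μ := integral_nonneg_of_ae hnn
  have hMB : ∫ t, (t + lam) ∂μ ≤ A + lam := by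
    have : ∫ t, (t + lam) ∂μ ≤ ∫ _, (A + lam) ∂μ :=
      integral_mono_ae hint (integrable_const _)
        (hμ.ae_mem.mono fun x hx => add_le_add_left hx.2 lam)
    simpa using this
  have hMpos : ∀ᵐ x ∂μ, 0 < x + lam → 0 < ∫ t, (t + lam) ∂μ := by
    rcases hM0.eq_or_lt with h0 | h0
    · filter_upwards [(integral_eq_zero_iff_of_nonneg_ae hnn hint).1 h0.symm] with x hx hpos
      exact absurd hx hpos.ne'
    · exact Filter.Eventually.of_forall fun x _ => h0
  have hL : 0 ≤ Real.log ((A + lam) / ∫ t, (t + lam) ∂μ) := by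
    rcases hM0.eq_or_lt with h0 | h0
    · simp [← h0]
    · exact Real.log_nonneg ((one_le_div h0).2 hMB)
  have hML : (∫ t, (t + lam) ∂μ) * Real.log ((A + lam) / ∫ t, (t + lam) ∂μ) ≤ A + lam := by
    rcases hM0.eq_or_lt with h0 | h0
    · rw [← h0]
      simp only [zero_mul]
      positivity
    · have := mul_le_mul_of_nonneg_left (Real.log_le_self
        (show 0 ≤ (A + lam) / ∫ t, (t + lam) ∂μ by positivity)) h0.le
      rwa [mul_div_cancel₀ _ h0.ne'] at this
  unfold mutualInfo
  by_cases hi : Integrable (iFun lam μ) μ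
  · have hmono : ∫ x, iFun lam μ x ∂μ ≤
        ∫ x, ((x + lam) * Real.log ((A + lam) / ∫ t, (t + lam) ∂μ) + (A + lam)) ∂μ := by
      refine integral_mono_ae hi (hμ.integrable (by fun_prop)) ?_
      filter_upwards [hμ.ae_mem, hMpos] with x hx hp
      exact iFun_le hA hlam hμ hx hp hL
    rw [integral_add (hμ.integrable (by fun_prop)) (integrable_const _), integral_mul_const] at hmono
    simp only [integral_const, probReal_univ, one_smul] at hmono
    linarith
  · rw [integral_undef hi]
    positivity

/-- The equiprobable distribution on the two points `a` and `b`. -/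
def twoPoint (a b : ℝ) : Measure ℝ :=
  (2⁻¹ : ENNReal) • Measure.dirac a + (2⁻¹ : ENNReal) • Measure.dirac b

theorem integral_twoPoint (a b : ℝ) (f : ℝ → ℝ) :
    ∫ x, f x ∂(twoPoint a b) = (f a + f b) / 2 := by
  unfold twoPoint
  rw [integral_add_measure ((integrable_dirac (by simp)).smul_measure (by simp))
    ((integrable_dirac (by simp)).smul_measure (by simp)), integral_smul_measure,
    integral_smul_measure, integral_dirac, integral_dirac]
  simp
  ring

theorem isInput_twoPoint {A : ℝ} (hA : 0 < A) : IsInput A (twoPoint 0 A) := by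
  refine ⟨⟨?_⟩, ?_⟩
  · simp [twoPoint, ENNReal.inv_two_add_inv_two]
  · simp [twoPoint, hA.le]

theorem mutualInfo_twoPoint_pos {A lam : ℝ} (hA : 0 < A) (hlam : 0 ≤ lam) :
    0 < mutualInfo lam (twoPoint 0 A) := by
  have hp0 : ∀ y, 0 ≤ channelPMF lam 0 y := channelPMF_nonneg (by linarith)
  have hpA : ∀ y, 0 ≤ channelPMF lam A y := channelPMF_nonneg (by linarith)
  have hq : ∀ y, outputPMF lam (twoPoint 0 A) y =
      (channelPMF lam 0 y + channelPMF lam A y) / 2 := fun y => integral_twoPoint 0 A _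
  have hq0 : ∀ y, 0 ≤ outputPMF lam (twoPoint 0 A) y := fun y => by
    rw [hq]
    linarith [hp0 y, hpA y]
  have hq1 : HasSum (outputPMF lam (twoPoint 0 A)) 1 := by
    have h := ((hasSum_channelPMF lam 0).add (hasSum_channelPMF lam A)).div_const 2
    rw [one_add_one_eq_two, div_self two_ne_zero] at h
    exact h.congr_fun hq
  have hlt : channelPMF lam A 0 < channelPMF lam 0 0 := by
    simp [channelPMF, hA]
  have hpA0 : 0 < channelPMF lam A 0 := by
    simp [channelPMF, Real.exp_pos]
  have h0 : 0 < iFun lam (twoPoint 0 A) 0 :=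
    klDiv_pos (c := 2) (n := 0) hp0 (hasSum_channelPMF lam 0) hq0 hq1
      (fun y => by rw [hq]; linarith [hpA y]) (hpA0.trans hlt) (by rw [hq]; intro h; linarith)
  have h1 : 0 < iFun lam (twoPoint 0 A) A :=
    klDiv_pos (c := 2) (n := 0) hpA (hasSum_channelPMF lam A) hq0 hq1
      (fun y => by rw [hq]; linarith [hp0 y]) hpA0 (by rw [hq]; intro h; linarith)
  unfold mutualInfo
  rw [integral_twoPoint]
  linarith

theorem capacity_pos {A lam : ℝ} (hA : 0 < A) (hlam : 0 ≤ lam) : 0 < capacity A lam := by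
  refine (mutualInfo_twoPoint_pos hA hlam).trans_le (le_csSup ⟨2 * (A + lam), ?_⟩ ?_)
  · rintro _ ⟨μ, hμ, rfl⟩
    exact mutualInfo_le hA hlam hμ
  · exact ⟨_, isInput_twoPoint hA, rfl⟩

theorem msupport_eq_support (μ : Measure ℝ) : msupport μ = μ.support := by
  rw [Measure.support_eq_forall_isOpen]
  ext x
  exact ⟨fun h U hx hU => h U hU hx, fun h U hU hx => h U hx hU⟩

theorem integral_eq_sum_of_ae_mem {μ : Measure ℝ} [IsFiniteMeasure μ] {s : Finset ℝ}
    (hs : ∀ᵐ x ∂μ, x ∈ (s : Set ℝ)) (f : ℝ → ℝ) :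
    ∫ x, f x ∂μ = ∑ x ∈ s, μ.real {x} * f x := by
  conv_lhs => rw [← Measure.restrict_eq_self_of_ae_mem hs]
  rw [setIntegral_finset s (IntegrableOn.finset)]
  simp

theorem mutualInfo_le_log_card {A lam : ℝ} (hlam : 0 ≤ lam) {μ : Measure ℝ}
    (hμ : IsInput A μ) {s : Finset ℝ} (hs : ∀ᵐ x ∂μ, x ∈ (s : Set ℝ)) :
    mutualInfo lam μ ≤ Real.log s.card := by
  have := hμ.1
  have hsum : ∑ x ∈ s, μ.real {x} = 1 := by
    have := integral_eq_sum_of_ae_mem hs fun _ => 1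
    simpa using this.symm
  have hn : (0 : ℝ) < s.card := by
    rw [Nat.cast_pos, Finset.card_pos, Finset.nonempty_iff_ne_empty]
    rintro rfl
    simp at hsum
  have hin : ∀ x, μ.real {x} ≠ 0 → 0 ≤ x + lam := fun x hx => by
    by_contra hneg
    refine hx ((measureReal_eq_zero_iff).2 (measure_mono_null ?_ hμ.2))
    rintro _ rfl h
    exact hneg (add_nonneg h.1 hlam)
  have hterm : ∀ z y, 0 ≤ μ.real {z} * channelPMF lam z y := fun z y => by
    by_cases hz : μ.real {z} = 0
    · simp [hz]
    · exact mul_nonneg measureReal_nonneg (channelPMF_nonneg (hin z hz) y)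
  have hout : ∀ y, outputPMF lam μ y = ∑ x ∈ s, μ.real {x} * channelPMF lam x y :=
    fun y => integral_eq_sum_of_ae_mem hs _
  have key : ∀ x ∈ s, μ.real {x} * iFun lam μ x ≤
      μ.real {x} * Real.log s.card + ((s.card : ℝ)⁻¹ - μ.real {x}) := by
    intro x hx
    rcases (measureReal_nonneg (μ := μ) (s := {x})).eq_or_lt with h0 | h0
    · simp [← h0]
    · have hi : iFun lam μ x ≤ Real.log (μ.real {x})⁻¹ := by
        refine klDiv_le_log ((one_le_inv₀ h0).2 measureReal_le_one)
          (channelPMF_nonneg (hin x h0.ne')) (hasSum_channelPMF lam x)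
          (fun y => ?_) fun y => ?_
        · rw [hout]
          exact Finset.sum_nonneg fun z _ => hterm z y
        · rw [inv_mul_eq_div, le_div_iff₀ h0, hout, mul_comm]
          exact Finset.single_le_sum (f := fun z => μ.real {z} * channelPMF lam z y)
            (fun z _ => hterm z y) hx
      have hl := Real.log_le_sub_one_of_pos
        (show 0 < (μ.real {x})⁻¹ * (s.card : ℝ)⁻¹ by positivity)
      rw [Real.log_mul (by positivity) (by positivity), Real.log_inv (s.card : ℝ)] at hl
      have hle : iFun lam μ x ≤ Real.log s.card + ((μ.real {x})⁻¹ * (s.card : ℝ)⁻¹ - 1) := by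
        linarith
      refine (mul_le_mul_of_nonneg_left hle h0.le).trans (le_of_eq ?_)
      field_simp
  unfold mutualInfo
  rw [integral_eq_sum_of_ae_mem hs]
  refine (Finset.sum_le_sum key).trans (le_of_eq ?_)
  rw [Finset.sum_add_distrib, Finset.sum_sub_distrib, ← Finset.sum_mul, hsum, Finset.sum_const,
    nsmul_eq_mul, mul_inv_cancel₀ hn.ne']
  ring

/-- Lower bound on the number of support points. -/
theorem support_card_lower_bound (A lam : ℝ) (hA : 0 < A) (hlam : 0 ≤ lam)
    (μ : Measure ℝ) (hμ : IsCapacityAchieving A lam μ) :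
    (⌈max 2 (Real.exp (capacity A lam))⌉₊ : ℕ∞) ≤ (msupport μ).encard := by
  rcases (msupport μ).finite_or_infinite with hfin | hinf
  · have hs : ∀ᵐ x ∂μ, x ∈ (hfin.toFinset : Set ℝ) := by
      rw [hfin.coe_toFinset, msupport_eq_support]
      exact Measure.support_mem_ae
    have hC : capacity A lam ≤ Real.log hfin.toFinset.card :=
      hμ.2 ▸ mutualInfo_le_log_card hlam hμ.1 hs
    have hlog := (capacity_pos hA hlam).trans_le hC
    have hcard : 2 ≤ hfin.toFinset.card := by
      by_contra! h
      interval_cases hfin.toFinset.card <;> simp at hlog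
    rw [hfin.encard_eq_coe_toFinset_card, Nat.cast_le, Nat.ceil_le]
    refine max_le (by exact_mod_cast hcard) ?_
    rwa [← Real.le_log_iff_exp_le (by exact_mod_cast (by omega : 0 < hfin.toFinset.card))]
  · rw [hinf.encard_eq]
    exact le_top
end
end

section
/- Let A > 0, λ ≥ 0, and let μ be a probability measure supported in [0,A] with μ((0,A]) > 0 or λ > 0, so that m_y := ∫ (x+λ)^y e^{-(x+λ)} dμ(x) > 0 for all y ∈ ℕ. Define G(x) = Σ_{y=0}^∞ P_{Y|X}(y|x) · log(1/(y! · P_Y(y))), where P_Y(y) = m_y/y!. Then for every x > 0, G is twice differentiable at x and G''(x) = Σ_{y=0}^∞ P_{Y|X}(y|x) · log(m_{y+1}² / (m_y · m_{y+2})). -/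
open MeasureTheory Real Set

noncomputable section

/-- `m_y = ∫ (x+lam)^y e^{-(x+lam)} dμ(x)`, so the output pmf is `P_Y(y) = m_y / y!`. -/
def mom (lam : ℝ) (μ : Measure ℝ) (y : ℕ) : ℝ :=
  ∫ x, (x + lam) ^ y * Real.exp (-(x + lam)) ∂μ

/-- `G(x) = Σ_y P_{Y|X}(y|x) log(1 / (y! P_Y(y)))` with `P_Y(y) = m_y / y!`. -/
def GFun (lam : ℝ) (μ : Measure ℝ) (x : ℝ) : ℝ :=
  ∑' y : ℕ, channelPMF lam x y *
    Real.log (1 / ((Nat.factorial y : ℝ) * (mom lam μ y / (Nat.factorial y : ℝ))))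

theorem summable_pow_div_factorial_mul {a : ℕ → ℝ} {K R : ℝ}
    (ha : ∀ y, |a y| ≤ K * R ^ y) (t : ℝ) :
    Summable fun y : ℕ => t ^ y / (Nat.factorial y : ℝ) * a y := by
  refine Summable.of_norm_bounded
    ((Real.summable_pow_div_factorial (|t| * R)).mul_left K) fun y => ?_
  rw [norm_mul, norm_div, norm_pow, Real.norm_eq_abs, Real.norm_eq_abs, Real.norm_eq_abs,
    Nat.abs_cast]
  calc |t| ^ y / (Nat.factorial y : ℝ) * |a y|
      ≤ |t| ^ y / (Nat.factorial y : ℝ) * (K * R ^ y) := by gcongr; exact ha y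
    _ = K * ((|t| * R) ^ y / (Nat.factorial y : ℝ)) := by rw [mul_pow]; ring

theorem abs_shift_le {a : ℕ → ℝ} {K R : ℝ} (ha : ∀ y, |a y| ≤ K * R ^ y) (y : ℕ) :
    |a (y + 1)| ≤ (K * R) * R ^ y :=
  (ha (y + 1)).trans_eq (by ring)

theorem succ_mul_pow_div_factorial (t b : ℝ) (y : ℕ) :
    ((y + 1 : ℕ) : ℝ) * t ^ (y + 1 - 1) / (Nat.factorial (y + 1) : ℝ) * b =
      t ^ y / (Nat.factorial y : ℝ) * b := by
  have h1 : ((y : ℝ) + 1) ≠ 0 := by positivity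
  have h2 : (Nat.factorial y : ℝ) ≠ 0 := by positivity
  rw [Nat.factorial_succ, Nat.add_sub_cancel]
  push_cast
  field_simp

/-- An exponential generating function with geometrically bounded coefficients may be
differentiated by shifting its coefficients. -/
theorem hasDerivAt_tsum_pow_div_factorial {a : ℕ → ℝ} {K R : ℝ}
    (ha : ∀ y, |a y| ≤ K * R ^ y) (t : ℝ) :
    HasDerivAt (fun t => ∑' y : ℕ, t ^ y / (Nat.factorial y : ℝ) * a y)
      (∑' y : ℕ, t ^ y / (Nat.factorial y : ℝ) * a (y + 1)) t := by
  set r : ℝ := |t| + 1 with hr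
  have hr0 : 0 < r := by positivity
  have hu : Summable fun y : ℕ =>
      (y : ℝ) * r ^ (y - 1) / (Nat.factorial y : ℝ) * |a y| := by
    rw [← summable_nat_add_iff 1]
    simp_rw [succ_mul_pow_div_factorial]
    exact summable_pow_div_factorial_mul (a := fun y => |a (y + 1)|)
      (fun y => by rw [abs_abs]; exact abs_shift_le ha y) r
  have ht : t ∈ Metric.ball (0 : ℝ) r := by
    rw [Metric.mem_ball, dist_zero_right, Real.norm_eq_abs]; linarith
  have hd := hasDerivAt_tsum_of_isPreconnected
    (g := fun (y : ℕ) (s : ℝ) => s ^ y / (Nat.factorial y : ℝ) * a y)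
    (g' := fun (y : ℕ) (s : ℝ) => (y : ℝ) * s ^ (y - 1) / (Nat.factorial y : ℝ) * a y)
    hu Metric.isOpen_ball (convex_ball (0 : ℝ) r).isPreconnected
    (fun y s _ => ((hasDerivAt_pow y s).div_const _).mul_const _)
    (fun y s hs => by
      rw [Metric.mem_ball, dist_zero_right] at hs
      rw [norm_mul, norm_div, norm_mul, norm_pow, Real.norm_natCast, Real.norm_natCast,
        Real.norm_eq_abs (a y)]
      gcongr)
    ht (summable_pow_div_factorial_mul ha t) ht
  have hs : Summable fun y : ℕ =>
      (y : ℝ) * t ^ (y - 1) / (Nat.factorial y : ℝ) * a y := by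
    rw [← summable_nat_add_iff 1]
    simp_rw [succ_mul_pow_div_factorial]
    exact summable_pow_div_factorial_mul (abs_shift_le ha) t
  rw [hs.tsum_eq_zero_add] at hd
  simp_rw [succ_mul_pow_div_factorial] at hd
  simpa using hd

theorem channelPMF_mul (lam x b : ℝ) (y : ℕ) :
    channelPMF lam x y * b =
      Real.exp (-(x + lam)) * ((x + lam) ^ y / (Nat.factorial y : ℝ) * b) := by
  unfold channelPMF; ring

/-- Differentiating a Poisson mean amounts to taking the forward difference of the integrand. -/
theorem hasDerivAt_tsum_channelPMF_mul {a : ℕ → ℝ} {K R : ℝ}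
    (ha : ∀ y, |a y| ≤ K * R ^ y) (lam x : ℝ) :
    HasDerivAt (fun x => ∑' y : ℕ, channelPMF lam x y * a y)
      (∑' y : ℕ, channelPMF lam x y * (a (y + 1) - a y)) x := by
  simp_rw [channelPMF_mul, tsum_mul_left]
  have h1 : HasDerivAt (fun x : ℝ => x + lam) 1 x := (hasDerivAt_id x).add_const lam
  have h2 := (hasDerivAt_tsum_pow_div_factorial ha (x + lam)).comp x h1
  refine (h1.neg.exp.mul h2).congr_deriv ?_
  simp_rw [mul_sub]
  rw [(summable_pow_div_factorial_mul (abs_shift_le ha) (x + lam)).tsum_sub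
    (summable_pow_div_factorial_mul ha (x + lam))]
  simp only [Function.comp, Pi.neg_apply]
  ring

theorem pow_mul_exp_neg_le {A lam x : ℝ} (hlam : 0 ≤ lam) (hx : x ∈ Set.Icc 0 A) (y : ℕ) :
    (x + lam) ^ y * Real.exp (-(x + lam)) ≤ (A + lam) ^ y := by
  have h0 : 0 ≤ x + lam := add_nonneg hx.1 hlam
  calc (x + lam) ^ y * Real.exp (-(x + lam)) ≤ (x + lam) ^ y :=
        mul_le_of_le_one_right (pow_nonneg h0 _) (Real.exp_le_one_iff.2 (by linarith))
    _ ≤ (A + lam) ^ y := by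
        gcongr
        exact hx.2

theorem integrable_mom {A lam : ℝ} (hlam : 0 ≤ lam) (μ : Measure ℝ) [IsProbabilityMeasure μ]
    (hsupp : ∀ᵐ x ∂μ, x ∈ Set.Icc 0 A) (y : ℕ) :
    Integrable (fun x => (x + lam) ^ y * Real.exp (-(x + lam))) μ := by
  refine Integrable.of_bound (by fun_prop) ((A + lam) ^ y) ?_
  filter_upwards [hsupp] with x hx
  have h0 : 0 ≤ x + lam := add_nonneg hx.1 hlam
  rw [Real.norm_of_nonneg (by positivity)]
  exact pow_mul_exp_neg_le hlam hx y

theorem mom_le {A lam : ℝ} (hlam : 0 ≤ lam) (μ : Measure ℝ) [IsProbabilityMeasure μ]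
    (hsupp : ∀ᵐ x ∂μ, x ∈ Set.Icc 0 A) (y : ℕ) : mom lam μ y ≤ (A + lam) ^ y := by
  have h : mom lam μ y ≤ ∫ _, (A + lam) ^ y ∂μ := by
    refine integral_mono_ae (integrable_mom hlam μ hsupp y) (integrable_const _) ?_
    filter_upwards [hsupp] with x hx
    exact pow_mul_exp_neg_le hlam hx y
  simpa using h

theorem exists_measure_Icc_pos {A lam : ℝ} (hlam : 0 ≤ lam)
    (μ : Measure ℝ) [IsProbabilityMeasure μ] (hsupp : μ (Set.Icc 0 A)ᶜ = 0)
    (hpos : 0 < μ (Set.Ioc 0 A) ∨ 0 < lam) :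
    ∃ d, 0 ≤ d ∧ 0 < d + lam ∧ 0 < μ (Set.Icc d A) := by
  rcases hpos with h | h
  · have hsub : Set.Ioc 0 A ⊆ ⋃ n : ℕ, Set.Icc (1 / ((n : ℝ) + 1)) A := fun x hx => by
      obtain ⟨n, hn⟩ := exists_nat_one_div_lt hx.1
      exact Set.mem_iUnion.2 ⟨n, hn.le, hx.2⟩
    obtain ⟨n, hn⟩ := exists_measure_pos_of_not_measure_iUnion_null
      (h.trans_le (measure_mono hsub)).ne'
    exact ⟨1 / ((n : ℝ) + 1), by positivity, by positivity, hn⟩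
  · refine ⟨0, le_rfl, by simpa using h, ?_⟩
    rw [(prob_compl_eq_zero_iff measurableSet_Icc).1 hsupp]
    exact one_pos

theorem exists_le_mom {A lam : ℝ} (hlam : 0 ≤ lam)
    (μ : Measure ℝ) [IsProbabilityMeasure μ] (hsupp : μ (Set.Icc 0 A)ᶜ = 0)
    (hpos : 0 < μ (Set.Ioc 0 A) ∨ 0 < lam) :
    ∃ c d : ℝ, 0 < c ∧ 0 < d ∧ ∀ y, c * d ^ y ≤ mom lam μ y := by
  obtain ⟨d, hd0, hd, hm⟩ := exists_measure_Icc_pos hlam μ hsupp hpos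
  have hae : ∀ᵐ x ∂μ, x ∈ Set.Icc 0 A := hsupp
  refine ⟨μ.real (Set.Icc d A) * Real.exp (-(A + lam)), d + lam,
    mul_pos (ENNReal.toReal_pos hm.ne' (measure_ne_top _ _)) (Real.exp_pos _), hd, fun y => ?_⟩
  have hint := integrable_mom hlam μ hae y
  calc μ.real (Set.Icc d A) * Real.exp (-(A + lam)) * (d + lam) ^ y
      = ∫ _ in Set.Icc d A, (d + lam) ^ y * Real.exp (-(A + lam)) ∂μ := by
        rw [setIntegral_const, smul_eq_mul]; ring
    _ ≤ ∫ x in Set.Icc d A, (x + lam) ^ y * Real.exp (-(x + lam)) ∂μ := by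
        refine setIntegral_mono_on (integrable_const _) hint.integrableOn measurableSet_Icc
          fun x hx => ?_
        have h0 : 0 ≤ x + lam := by linarith [hx.1]
        gcongr
        · exact hx.1
        · exact hx.2
    _ ≤ mom lam μ y := by
        refine setIntegral_le_integral hint ?_
        filter_upwards [hae] with x hx
        have h0 : 0 ≤ x + lam := add_nonneg hx.1 hlam
        exact mul_nonneg (pow_nonneg h0 _) (Real.exp_pos _).le

theorem exists_abs_log_mom_le {A lam : ℝ} (hlam : 0 ≤ lam)
    (μ : Measure ℝ) [IsProbabilityMeasure μ] (hsupp : μ (Set.Icc 0 A)ᶜ = 0)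
    (hpos : 0 < μ (Set.Ioc 0 A) ∨ 0 < lam) :
    (∀ y, 0 < mom lam μ y) ∧ ∃ K, ∀ y, |Real.log (mom lam μ y)| ≤ K * 2 ^ y := by
  obtain ⟨c, d, hc, hd, h⟩ := exists_le_mom hlam μ hsupp hpos
  have hm : ∀ y, 0 < mom lam μ y := fun y => (by positivity : 0 < c * d ^ y).trans_le (h y)
  refine ⟨hm, |Real.log c| + |Real.log d| + |Real.log (A + lam)|, fun y => ?_⟩
  have hl : Real.log c + y * Real.log d ≤ Real.log (mom lam μ y) := by
    rw [← Real.log_pow, ← Real.log_mul hc.ne' (by positivity)]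
    exact Real.log_le_log (by positivity) (h y)
  have hu : Real.log (mom lam μ y) ≤ y * Real.log (A + lam) := by
    rw [← Real.log_pow]
    exact Real.log_le_log (hm y) (mom_le hlam μ hsupp y)
  have hy : (y : ℝ) ≤ 2 ^ y := by exact_mod_cast Nat.lt_two_pow_self.le
  have h1 : (1 : ℝ) ≤ 2 ^ y := one_le_pow₀ (by norm_num)
  have hy0 : (0 : ℝ) ≤ y := Nat.cast_nonneg y
  have e1 : |Real.log c| ≤ |Real.log c| * 2 ^ y := le_mul_of_one_le_right (abs_nonneg _) h1
  have e2 : y * |Real.log d| ≤ |Real.log d| * 2 ^ y := by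
    rw [mul_comm]; gcongr
  have e3 : y * |Real.log (A + lam)| ≤ |Real.log (A + lam)| * 2 ^ y := by
    rw [mul_comm]; gcongr
  have e4 : -(y * |Real.log d|) ≤ y * Real.log d := by
    rw [← mul_neg]; exact mul_le_mul_of_nonneg_left (neg_abs_le _) hy0
  have e5 : y * Real.log (A + lam) ≤ y * |Real.log (A + lam)| :=
    mul_le_mul_of_nonneg_left (le_abs_self _) hy0
  have e6 := neg_abs_le (Real.log c)
  have p1 : 0 ≤ |Real.log c| * 2 ^ y := by positivity
  have p2 : 0 ≤ |Real.log d| * 2 ^ y := by positivity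
  have p3 : 0 ≤ |Real.log (A + lam)| * 2 ^ y := by positivity
  rw [abs_le, add_mul, add_mul]
  constructor <;> linarith

/-- Second derivative identity for `G`. -/
theorem GFun_second_deriv (A lam : ℝ) (hA : 0 < A) (hlam : 0 ≤ lam)
    (μ : Measure ℝ) [IsProbabilityMeasure μ] (hsupp : μ (Set.Icc 0 A)ᶜ = 0)
    (hpos : 0 < μ (Set.Ioc 0 A) ∨ 0 < lam)
    (x : ℝ) (hx : 0 < x) :
    DifferentiableAt ℝ (GFun lam μ) x ∧
      HasDerivAt (deriv (GFun lam μ))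
        (∑' y : ℕ, channelPMF lam x y *
          Real.log ((mom lam μ (y + 1)) ^ 2 / (mom lam μ y * mom lam μ (y + 2)))) x := by
  obtain ⟨hm, K, hK⟩ := exists_abs_log_mom_le hlam μ hsupp hpos
  set a : ℕ → ℝ := fun y => -Real.log (mom lam μ y) with ha_def
  have ha : ∀ y, |a y| ≤ K * 2 ^ y := fun y => by rw [ha_def, abs_neg]; exact hK y
  have hG : GFun lam μ = fun x => ∑' y : ℕ, channelPMF lam x y * a y := by
    funext x
    refine tsum_congr fun y => ?_
    rw [mul_div_cancel₀ _ (by positivity), one_div, Real.log_inv]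
  have hd : ∀ x, HasDerivAt (GFun lam μ)
      (∑' y : ℕ, channelPMF lam x y * (a (y + 1) - a y)) x := fun x => by
    rw [hG]; exact hasDerivAt_tsum_channelPMF_mul ha lam x
  refine ⟨(hd x).differentiableAt, ?_⟩
  have hb : ∀ y, |a (y + 1) - a y| ≤ (K * 2 + K) * 2 ^ y := fun y => by
    rw [add_mul]
    exact (abs_sub _ _).trans (add_le_add (abs_shift_le ha y) (ha y))
  rw [funext fun x => (hd x).deriv]
  refine (hasDerivAt_tsum_channelPMF_mul hb lam x).congr_deriv ?_
  refine tsum_congr fun y => ?_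
  rw [Real.log_div (pow_ne_zero 2 (hm _).ne') (mul_pos (hm _) (hm _)).ne', Real.log_pow,
    Real.log_mul (hm _).ne' (hm _).ne']
  simp only [ha_def]
  push_cast
  ring
end
end
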